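/- In the single-variable DSD fitting problem, assume S_c + S_r > 0. If (α*, β*, γ*) is a global minimizer of f over the feasible region {α ≥ 0, β ≥ 0, γ ∈ ℝ} with β* = 0 and α* > 0, then α* = (S_{rr} + S_{cc})/(S_c + S_r) and γ* = Ȳ − α* X̄. -/

import Mathlib

/-- The vertex is the only positive minimizer on `[0, ∞)` of a quadratic with positive leading
coefficient. -/
lemma eq_div_of_forall_quadratic_le {K L x : ℝ} (hK : 0 < K) (hx : 0 < x)
    (h : ∀ a, 0 ≤ a → K * x ^ 2 - 2 * L * x ≤ K * a ^ 2 - 2 * L * a) : x = L / K := by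
  have hL : 0 ≤ L := by
    by_contra! hL
    nlinarith [h 0 le_rfl, mul_pos hK (pow_pos hx 2), mul_pos (neg_pos.2 hL) hx]
  have hv := h (L / K) (div_nonneg hL hK.le)
  obtain ⟨t, rfl⟩ : ∃ t, L = K * t := ⟨L / K, by field_simp⟩
  rw [mul_div_cancel_left₀ t hK.ne'] at hv ⊢
  have hsq : (x - t) ^ 2 ≤ 0 := by
    by_contra! hlt
    nlinarith [mul_pos hK hlt]
  exact sub_eq_zero.1 (pow_eq_zero_iff two_ne_zero |>.1 (le_antisymm hsq (sq_nonneg _)))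

lemma sum_sub_mean_eq_zero {m : ℕ} (hm : (m : ℝ) ≠ 0) (c : Fin m → ℝ) :
    ∑ j, (c j - (1 / (m : ℝ)) * ∑ i, c i) = 0 := by
  rw [Finset.sum_sub_distrib, Finset.sum_const, Finset.card_univ, Fintype.card_fin, nsmul_eq_mul]
  field_simp
  ring

/-- Completing the square in the intercept, for data centred at `x` and `y`. -/
lemma sum_sq_residual_eq {m : ℕ} (cX rX cY rY : Fin m → ℝ) {x y : ℝ}
    (hx : ∑ j, (cX j - x) = 0) (hy : ∑ j, (cY j - y) = 0) (a g : ℝ) :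
    ∑ j, ((cY j - a * cX j - g) ^ 2 + (1 / 3) * (rY j - a * rX j) ^ 2) =
      (∑ j, (cY j - y) ^ 2 + (1 / 3) * ∑ j, rY j ^ 2)
        + (∑ j, (cX j - x) ^ 2 + (1 / 3) * ∑ j, rX j ^ 2) * a ^ 2
        - 2 * ((1 / 3) * ∑ j, rX j * rY j + ∑ j, (cY j - y) * (cX j - x)) * a
        + m * (y - a * x - g) ^ 2 := by
  have hterm : ∀ j, (cY j - a * cX j - g) ^ 2 + (1 / 3) * (rY j - a * rX j) ^ 2 =
      (cY j - y) ^ 2 + (1 / 3) * rY j ^ 2 + a ^ 2 * (cX j - x) ^ 2 + (a ^ 2 / 3) * rX j ^ 2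
        + (-(2 * a) / 3) * (rX j * rY j) + (-(2 * a)) * ((cY j - y) * (cX j - x))
        + (y - a * x - g) ^ 2 + (2 * (y - a * x - g)) * (cY j - y)
        + (-(2 * a * (y - a * x - g))) * (cX j - x) := fun j => by ring
  simp only [hterm, Finset.sum_add_distrib, ← Finset.mul_sum, hx, hy, Finset.sum_const,
    Finset.card_univ, Fintype.card_fin, nsmul_eq_mul]
  ring

/-- Single-variable DSD fitting: if `S_c + S_r > 0` and `(α*, β*, γ*)` is a
global minimizer of `f` over `{α ≥ 0, β ≥ 0, γ ∈ ℝ}` with `β* = 0` and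
`α* > 0`, then `α* = (S_rr + S_cc)/(S_c + S_r)` and `γ* = Ȳ − α* X̄`. -/
theorem dsd_single_minimizer_beta_zero (m : ℕ) (hm : 1 ≤ m)
    (cX rX cY rY : Fin m → ℝ) (hrX : ∀ j, 0 ≤ rX j) (hrY : ∀ j, 0 ≤ rY j)
    (f : ℝ → ℝ → ℝ → ℝ)
    (hf : f = fun a b g => ∑ j, ((cY j - (a - b) * cX j - g) ^ 2
        + (1 / 3) * (rY j - (a + b) * rX j) ^ 2))
    (Xbar Ybar Sc Sr Scc Srr : ℝ)
    (hXbar : Xbar = (1 / (m : ℝ)) * ∑ j, cX j)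
    (hYbar : Ybar = (1 / (m : ℝ)) * ∑ j, cY j)
    (hSc : Sc = ∑ j, (cX j - Xbar) ^ 2)
    (hSr : Sr = (1 / 3) * ∑ j, (rX j) ^ 2)
    (hScc : Scc = ∑ j, (cY j - Ybar) * (cX j - Xbar))
    (hSrr : Srr = (1 / 3) * ∑ j, rX j * rY j)
    (hpos : 0 < Sc + Sr)
    (α β γ : ℝ) (hβ : β = 0) (hα : 0 < α)
    (hmin : ∀ a b g : ℝ, 0 ≤ a → 0 ≤ b → f α β γ ≤ f a b g) :
    α = (Srr + Scc) / (Sc + Sr) ∧ γ = Ybar - α * Xbar := by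
  have hm0 : (0 : ℝ) < m := by exact_mod_cast hm
  have key : ∀ a g, f a 0 g = (∑ j, (cY j - Ybar) ^ 2 + (1 / 3) * ∑ j, rY j ^ 2)
      + (Sc + Sr) * a ^ 2 - 2 * (Srr + Scc) * a + m * (Ybar - a * Xbar - g) ^ 2 := by
    intro a g
    have hX : ∑ j, (cX j - Xbar) = 0 := hXbar ▸ sum_sub_mean_eq_zero hm0.ne' cX
    have hY : ∑ j, (cY j - Ybar) = 0 := hYbar ▸ sum_sub_mean_eq_zero hm0.ne' cY
    rw [hSc, hSr, hSrr, hScc, ← sum_sq_residual_eq cX rX cY rY hX hY a g, hf]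
    simp only [sub_zero, add_zero]
  subst hβ
  have hγ : γ = Ybar - α * Xbar := by
    have h := hmin α 0 (Ybar - α * Xbar) hα.le le_rfl
    rw [key, key, sub_self] at h
    have hsq : (Ybar - α * Xbar - γ) ^ 2 ≤ 0 := by
      by_contra! hlt
      nlinarith [mul_pos hm0 hlt]
    have := pow_eq_zero_iff two_ne_zero |>.1 (le_antisymm hsq (sq_nonneg _))
    linarith
  refine ⟨eq_div_of_forall_quadratic_le hpos hα fun a ha => ?_, hγ⟩
  have h := hmin a 0 (Ybar - a * Xbar) ha le_rfl
  rw [key, key, hγ, sub_self, sub_self] at h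
  linarith
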